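/- Let (E, ℰ) be a measurable space, κ > 0, and for each n ≥ 1 let ℓ_{n−1} : E → ℝ be measurable with κ ≤ ℓ_{n−1}(u) ≤ 1/κ for all u ∈ E, let K_n be a Markov kernel on E, and let Φ_n be the map on probability measures defined by (Φ_n μ)(A) = (∫ ℓ_{n−1}(y) K_n(y, A) μ(dy)) / (∫ ℓ_{n−1} dμ). Let ν_0 be a probability measure on E and define ν_n = Φ_n ν_{n−1} for n ≥ 1. Let M ≥ 1 and suppose (ν_n^M)_{n≥0} is a sequence of random probability measures on E (defined on a probability space (Ω, F, P)) satisfying the per-step sampling error bounds d(ν_0^M, ν_0) ≤ 1/√M and d(ν_n^M, Φ_n ν_{n−1}^M) ≤ 1/√M for every n ≥ 1 (as holds for the sequential Monte Carlo particle approximation ν_n^M = S^M Φ_n ν_{n−1}^M with M conditionally i.i.d. samples per step). Then for every n ≥ 0, d(ν_n^M, ν_n) ≤ Σ_{j=0}^n (2κ^{−2})^j · (1/√M). -/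

import Mathlib

open MeasureTheory ProbabilityTheory

/-- The distance `d` between two random probability measures:
`d(μ,ν) = sup_{|f|_∞ ≤ 1} sqrt( E_ω |μ(ω)(f) − ν(ω)(f)|² )`. -/
noncomputable def dRPM {Ω E : Type*} [MeasurableSpace Ω] [MeasurableSpace E]
    (P : Measure Ω) (μ ν : Ω → Measure E) : ℝ :=
  sSup { r : ℝ | ∃ f : E → ℝ, Measurable f ∧ (∀ v, |f v| ≤ 1) ∧
    r = Real.sqrt (∫ ω, |(∫ x, f x ∂(μ ω)) - ∫ x, f x ∂(ν ω)| ^ 2 ∂P) }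

/-- A random probability measure: each realization is a probability measure and
integrals of bounded measurable functions are measurable in `ω`. -/
def IsRandomProbabilityMeasure {Ω E : Type*} [MeasurableSpace Ω] [MeasurableSpace E]
    (μ : Ω → Measure E) : Prop :=
  (∀ ω, IsProbabilityMeasure (μ ω)) ∧
    ∀ f : E → ℝ, Measurable f → (∀ v, |f v| ≤ 1) →
      Measurable fun ω => ∫ x, f x ∂(μ ω)

/-- The map on measures `(Φ μ)(A) = (∫ ℓ(y) K(y,A) μ(dy)) / μ(ℓ)`. -/
noncomputable def PhiMap {E : Type*} [MeasurableSpace E]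
    (ℓ : E → ℝ) (K : Kernel E E) (μ : Measure E) : Measure E :=
  (ENNReal.ofReal (∫ y, ℓ y ∂μ))⁻¹ •
    (μ.withDensity fun y => ENNReal.ofReal (ℓ y)).bind fun y => K y

theorem PhiMap_isProbabilityMeasure {E : Type*} [MeasurableSpace E]
    {ℓ : E → ℝ} {κ C : ℝ} (hκ : 0 < κ) (hℓm : Measurable ℓ) (hℓ : ∀ u, κ ≤ ℓ u ∧ ℓ u ≤ C)
    (K : Kernel E E) [IsMarkovKernel K] (μ : Measure E) [IsProbabilityMeasure μ] :
    IsProbabilityMeasure (PhiMap ℓ K μ) := by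
  have hint : Integrable ℓ μ := Integrable.of_bound hℓm.aestronglyMeasurable C
    (ae_of_all _ fun u => by
      rw [Real.norm_eq_abs, abs_of_pos (hκ.trans_le (hℓ u).1)]; exact (hℓ u).2)
  have hpos : κ ≤ ∫ y, ℓ y ∂μ := by
    simpa using integral_mono (integrable_const κ) hint fun u => (hℓ u).1
  constructor
  have hmass : (μ.withDensity fun y => ENNReal.ofReal (ℓ y)).bind (fun y => K y) Set.univ
      = ENNReal.ofReal (∫ y, ℓ y ∂μ) := by
    rw [Measure.bind_apply MeasurableSet.univ K.measurable.aemeasurable]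
    simp only [measure_univ, lintegral_const, one_mul]
    rw [withDensity_apply _ MeasurableSet.univ, Measure.restrict_univ,
      ofReal_integral_eq_lintegral_ofReal hint (ae_of_all _ fun u => (hκ.trans_le (hℓ u).1).le)]
  rw [PhiMap, Measure.smul_apply, hmass, smul_eq_mul]
  exact ENNReal.inv_mul_cancel (by simpa using hκ.trans_le hpos) ENNReal.ofReal_ne_top

theorem integral_PhiMap {E : Type*} [MeasurableSpace E]
    {ℓ : E → ℝ} {κ C : ℝ} (hκ : 0 < κ) (hℓm : Measurable ℓ) (hℓ : ∀ u, κ ≤ ℓ u ∧ ℓ u ≤ C)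
    (K : Kernel E E) [IsMarkovKernel K] (μ : Measure E) [IsProbabilityMeasure μ]
    {f : E → ℝ} (hf : Measurable f) (hf1 : ∀ v, |f v| ≤ 1) :
    ∫ x, f x ∂(PhiMap ℓ K μ) = (∫ y, ℓ y * ∫ z, f z ∂(K y) ∂μ) / ∫ y, ℓ y ∂μ := by
  have hℓ0 : ∀ u, 0 ≤ ℓ u := fun u => hκ.le.trans (hℓ u).1
  have hint : Integrable ℓ μ := Integrable.of_bound hℓm.aestronglyMeasurable C
    (ae_of_all _ fun u => by rw [Real.norm_eq_abs, abs_of_nonneg (hℓ0 u)]; exact (hℓ u).2)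
  have := isFiniteMeasure_withDensity_ofReal hint.2
  have hcomp : ∫ x, f x ∂((μ.withDensity fun y => ENNReal.ofReal (ℓ y)).bind fun y => K y)
      = ∫ y, ∫ z, f z ∂(K y) ∂(μ.withDensity fun y => ENNReal.ofReal (ℓ y)) := by
    have hfi : Integrable f
        ((K ∘ₖ Kernel.const Unit (μ.withDensity fun y => ENNReal.ofReal (ℓ y))) ()) :=
      Integrable.of_bound hf.aestronglyMeasurable 1 (ae_of_all _ hf1)
    simpa only [Kernel.comp_apply, Kernel.const_apply] using Kernel.integral_comp hfi
  rw [PhiMap, integral_smul_measure, hcomp,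
    integral_withDensity_eq_integral_toReal_smul hℓm.ennreal_ofReal
      (ae_of_all _ fun _ => ENNReal.ofReal_lt_top)]
  simp only [ENNReal.toReal_inv, ENNReal.toReal_ofReal (integral_nonneg hℓ0),
    ENNReal.toReal_ofReal (hℓ0 _), smul_eq_mul]
  rw [div_eq_inv_mul]

theorem integral_sq_le_of_abs_le_add {Ω : Type*} [MeasurableSpace Ω] {P : Measure Ω}
    {X Y Z : Ω → ℝ} {a b s t : ℝ} (ha : 0 ≤ a) (hb : 0 ≤ b) (hs : 0 < s) (ht : 0 < t)
    (hXi : Integrable (fun ω => |X ω| ^ 2) P) (hYi : Integrable (fun ω => |Y ω| ^ 2) P)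
    (hX : ∫ ω, |X ω| ^ 2 ∂P ≤ s ^ 2) (hY : ∫ ω, |Y ω| ^ 2 ∂P ≤ t ^ 2)
    (hZ : ∀ ω, |Z ω| ≤ a * |X ω| + b * |Y ω|) :
    ∫ ω, |Z ω| ^ 2 ∂P ≤ (a * s + b * t) ^ 2 := by
  have key : ∀ x y : ℝ, (a * x + b * y) ^ 2 ≤
      (a * s + b * t) * (a / s) * x ^ 2 + (a * s + b * t) * (b / t) * y ^ 2 := by
    intro x y
    have : (a * s + b * t) * (a / s) * x ^ 2 + (a * s + b * t) * (b / t) * y ^ 2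
        - (a * x + b * y) ^ 2 = a * b * (t * x - s * y) ^ 2 / (s * t) := by
      field_simp
      ring
    have : 0 ≤ a * b * (t * x - s * y) ^ 2 / (s * t) := by positivity
    linarith
  calc ∫ ω, |Z ω| ^ 2 ∂P
      ≤ ∫ ω, ((a * s + b * t) * (a / s) * |X ω| ^ 2
          + (a * s + b * t) * (b / t) * |Y ω| ^ 2) ∂P := by
        refine integral_mono_of_nonneg (ae_of_all _ fun _ => by positivity)
          ((hXi.const_mul _).add (hYi.const_mul _)) (ae_of_all _ fun ω => ?_)
        exact (pow_le_pow_left₀ (abs_nonneg _) (hZ ω) 2).trans (key _ _)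
    _ = (a * s + b * t) * (a / s) * ∫ ω, |X ω| ^ 2 ∂P
          + (a * s + b * t) * (b / t) * ∫ ω, |Y ω| ^ 2 ∂P := by
        rw [integral_add (hXi.const_mul _) (hYi.const_mul _), integral_const_mul,
          integral_const_mul]
    _ ≤ (a * s + b * t) * (a / s) * s ^ 2 + (a * s + b * t) * (b / t) * t ^ 2 := by
        gcongr
    _ = (a * s + b * t) ^ 2 := by
        field_simp

theorem abs_integral_le_one {E : Type*} [MeasurableSpace E] (μ : Measure E)
    [IsProbabilityMeasure μ] {f : E → ℝ} (hf : ∀ v, |f v| ≤ 1) : |∫ x, f x ∂μ| ≤ 1 := by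
  simpa using norm_integral_le_of_norm_le_const (μ := μ) (f := f) (C := 1) (ae_of_all _ hf)

theorem abs_integral_sub_integral_le_two {E : Type*} [MeasurableSpace E] (μ ν : Measure E)
    [IsProbabilityMeasure μ] [IsProbabilityMeasure ν] {f : E → ℝ} (hf : ∀ v, |f v| ≤ 1) :
    |∫ x, f x ∂μ - ∫ x, f x ∂ν| ≤ 2 :=
  (abs_sub _ _).trans (by linarith [abs_integral_le_one μ hf, abs_integral_le_one ν hf])

theorem dRPM_le_iff {Ω E : Type*} [MeasurableSpace Ω] [MeasurableSpace E]
    (P : Measure Ω) [IsProbabilityMeasure P] {μ ν : Ω → Measure E}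
    (hμ : ∀ ω, IsProbabilityMeasure (μ ω)) (hν : ∀ ω, IsProbabilityMeasure (ν ω))
    {s : ℝ} (hs : 0 ≤ s) :
    dRPM P μ ν ≤ s ↔ ∀ f : E → ℝ, Measurable f → (∀ v, |f v| ≤ 1) →
      ∫ ω, |∫ x, f x ∂(μ ω) - ∫ x, f x ∂(ν ω)| ^ 2 ∂P ≤ s ^ 2 := by
  constructor
  · intro h f hf hf1
    have hbdd : BddAbove { r : ℝ | ∃ f : E → ℝ, Measurable f ∧ (∀ v, |f v| ≤ 1) ∧
        r = Real.sqrt (∫ ω, |(∫ x, f x ∂(μ ω)) - ∫ x, f x ∂(ν ω)| ^ 2 ∂P) } := by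
      refine ⟨2, ?_⟩
      rintro _ ⟨g, -, hg1, rfl⟩
      refine Real.sqrt_le_iff.2 ⟨by norm_num, ?_⟩
      calc _ ≤ ∫ _, (2 : ℝ) ^ 2 ∂P :=
            integral_mono_of_nonneg (ae_of_all _ fun _ => by positivity) (integrable_const _)
              (ae_of_all _ fun ω => pow_le_pow_left₀ (abs_nonneg _)
                (abs_integral_sub_integral_le_two (μ ω) (ν ω) hg1) 2)
        _ = 2 ^ 2 := by simp
    exact (Real.sqrt_le_iff.1 ((le_csSup hbdd ⟨f, hf, hf1, rfl⟩).trans h)).2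
  · intro h
    refine csSup_le ⟨_, 0, measurable_const, by simp, rfl⟩ ?_
    rintro _ ⟨f, hf, hf1, rfl⟩
    exact Real.sqrt_le_iff.2 ⟨hs, h f hf hf1⟩

theorem IsRandomProbabilityMeasure.measurable_integral {Ω E : Type*} [MeasurableSpace Ω]
    [MeasurableSpace E] {μ : Ω → Measure E} (hμ : IsRandomProbabilityMeasure μ)
    {f : E → ℝ} (hf : Measurable f) {c : ℝ} (hc : 0 < c) (hfc : ∀ v, |c * f v| ≤ 1) :
    Measurable fun ω => ∫ x, f x ∂(μ ω) := by
  have h := (hμ.2 (fun v => c * f v) (hf.const_mul c) hfc).const_mul c⁻¹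
  simpa only [integral_const_mul, inv_mul_cancel_left₀ hc.ne'] using h

theorem abs_div_sub_div_le {κ a a' b b' : ℝ} (hκ : 0 < κ) (hb : κ ≤ b) (hb' : κ ≤ b')
    (hab : |a| ≤ b) :
    |a / b - a' / b'| ≤ 1 / κ * |a - a'| + 1 / κ * |b - b'| := by
  have hb0 := hκ.trans_le hb
  have hb0' := hκ.trans_le hb'
  have heq : a / b - a' / b' = 1 / b' * ((a - a') - a / b * (b - b')) := by
    field_simp
    ring
  have hq : |a / b| ≤ 1 := by
    rw [abs_div, abs_of_pos hb0]
    exact (div_le_one hb0).2 hab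
  rw [heq, abs_mul, abs_of_pos (by positivity : 0 < 1 / b'), ← mul_add]
  refine mul_le_mul (one_div_le_one_div_of_le hκ hb') ?_ (abs_nonneg _) (by positivity)
  refine (abs_sub _ _).trans (add_le_add_right ?_ _)
  rw [abs_mul]
  exact mul_le_of_le_one_left (abs_nonneg _) hq

/-- The triangle inequality for `dRPM` combined with the Lipschitz bound for `PhiMap`. -/
theorem dRPM_PhiMap_le {Ω E : Type*} [MeasurableSpace Ω] [MeasurableSpace E]
    (P : Measure Ω) [IsProbabilityMeasure P] {κ : ℝ} (hκ : 0 < κ)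
    {ℓ : E → ℝ} (hℓm : Measurable ℓ) (hℓ : ∀ u, κ ≤ ℓ u ∧ ℓ u ≤ 1 / κ)
    (K : Kernel E E) [IsMarkovKernel K] (ν : Measure E) [IsProbabilityMeasure ν]
    {μ μ' : Ω → Measure E} (hμ : IsRandomProbabilityMeasure μ)
    (hμ' : IsRandomProbabilityMeasure μ') {s t : ℝ} (hs : 0 < s) (ht : 0 < t)
    (h : dRPM P μ (fun _ => ν) ≤ t)
    (h' : dRPM P μ' (fun ω => PhiMap ℓ K (μ ω)) ≤ s) :
    dRPM P μ' (fun _ => PhiMap ℓ K ν) ≤ s + 2 / κ ^ 2 * t := by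
  have := hμ.1
  have := hμ'.1
  have hΦ (ρ : Measure E) [IsProbabilityMeasure ρ] : IsProbabilityMeasure (PhiMap ℓ K ρ) :=
    PhiMap_isProbabilityMeasure hκ hℓm hℓ K ρ
  rw [dRPM_le_iff P hμ.1 (fun _ => inferInstance) ht.le] at h
  rw [dRPM_le_iff P hμ'.1 (fun _ => inferInstance) hs.le] at h'
  rw [dRPM_le_iff P hμ'.1 (fun _ => inferInstance) (by positivity)]
  intro f hf hf1
  set g : E → ℝ := fun y => ℓ y * ∫ z, f z ∂(K y) with hg
  have hgm : Measurable g := hℓm.mul hf.stronglyMeasurable.integral_kernel.measurable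
  have hℓabs : ∀ v, |κ * ℓ v| ≤ 1 := fun v => by
    rw [abs_of_pos (mul_pos hκ (hκ.trans_le (hℓ v).1)), mul_comm]
    exact (le_div_iff₀ hκ).1 (hℓ v).2
  have hgℓ : ∀ v, |g v| ≤ ℓ v := fun v => by
    rw [hg, abs_mul, abs_of_pos (hκ.trans_le (hℓ v).1)]
    exact mul_le_of_le_one_right (hκ.trans_le (hℓ v).1).le (abs_integral_le_one (K v) hf1)
  have hgabs : ∀ v, |κ * g v| ≤ 1 := fun v => by
    refine le_trans ?_ (hℓabs v)
    rw [abs_mul κ, abs_mul κ]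
    exact mul_le_mul_of_nonneg_left ((hgℓ v).trans (le_abs_self _)) (abs_nonneg _)
  have hℓi (ρ : Measure E) [IsProbabilityMeasure ρ] : Integrable ℓ ρ :=
    Integrable.of_bound hℓm.aestronglyMeasurable (1 / κ) (ae_of_all _ fun u => by
      rw [Real.norm_eq_abs, abs_of_pos (hκ.trans_le (hℓ u).1)]; exact (hℓ u).2)
  have hℓκ (ρ : Measure E) [IsProbabilityMeasure ρ] : κ ≤ ∫ y, ℓ y ∂ρ := by
    simpa using integral_mono (integrable_const κ) (hℓi ρ) fun u => (hℓ u).1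
  have hgint (ρ : Measure E) [IsProbabilityMeasure ρ] : |∫ y, g y ∂ρ| ≤ ∫ y, ℓ y ∂ρ :=
    norm_integral_le_of_norm_le (f := g) (hℓi ρ) (ae_of_all _ hgℓ)
  have hΦf (ρ : Measure E) [IsProbabilityMeasure ρ] :
      ∫ x, f x ∂(PhiMap ℓ K ρ) = (∫ y, g y ∂ρ) / ∫ y, ℓ y ∂ρ :=
    integral_PhiMap hκ hℓm hℓ K ρ hf hf1
  have hΦmeas : Measurable fun ω => ∫ x, f x ∂(PhiMap ℓ K (μ ω)) := by
    simp only [hΦf]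
    exact (hμ.measurable_integral hgm hκ hgabs).div (hμ.measurable_integral hℓm hκ hℓabs)
  have hsqi {X : Ω → ℝ} (hX : Measurable X) (hX2 : ∀ ω, |X ω| ≤ 2) :
      Integrable (fun ω => |X ω| ^ 2) P :=
    Integrable.of_bound (by fun_prop) (2 ^ 2) (ae_of_all _ fun ω => by
      rw [norm_pow, Real.norm_eq_abs, abs_abs]
      exact pow_le_pow_left₀ (abs_nonneg _) (hX2 ω) 2)
  have hB := h (fun v => κ * g v) (hgm.const_mul κ) hgabs
  have hC := h (fun v => κ * ℓ v) (hℓm.const_mul κ) hℓabs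
  have hA := h' f hf hf1
  have hBi := hsqi ((hμ.2 _ (hgm.const_mul κ) hgabs).sub_const (∫ v, κ * g v ∂ν))
    fun ω => abs_integral_sub_integral_le_two (μ ω) ν hgabs
  have hCi := hsqi ((hμ.2 _ (hℓm.const_mul κ) hℓabs).sub_const (∫ v, κ * ℓ v ∂ν))
    fun ω => abs_integral_sub_integral_le_two (μ ω) ν hℓabs
  have hAi := hsqi ((hμ'.2 f hf hf1).sub hΦmeas)
    fun ω => abs_integral_sub_integral_le_two (μ' ω) (PhiMap ℓ K (μ ω)) hf1
  have hDi := hsqi (hΦmeas.sub_const (∫ x, f x ∂(PhiMap ℓ K ν)))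
    fun ω => abs_integral_sub_integral_le_two (PhiMap ℓ K (μ ω)) (PhiMap ℓ K ν) hf1
  have hD : ∫ ω, |∫ x, f x ∂(PhiMap ℓ K (μ ω)) - ∫ x, f x ∂(PhiMap ℓ K ν)| ^ 2 ∂P
      ≤ (1 / κ ^ 2 * t + 1 / κ ^ 2 * t) ^ 2 := by
    refine integral_sq_le_of_abs_le_add (by positivity) (by positivity) ht ht hBi hCi hB hC ?_
    intro ω
    rw [hΦf, hΦf]
    refine (abs_div_sub_div_le hκ (hℓκ (μ ω)) (hℓκ ν) (hgint (μ ω))).trans_eq ?_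
    simp only [integral_const_mul, ← mul_sub, abs_mul, abs_of_pos hκ]
    field_simp
  refine (integral_sq_le_of_abs_le_add zero_le_one zero_le_one hs
    (by positivity : 0 < 1 / κ ^ 2 * t + 1 / κ ^ 2 * t) hAi hDi hA hD fun ω => ?_).trans_eq ?_
  · simpa only [one_mul, Pi.sub_apply] using abs_sub_le (∫ x, f x ∂(μ' ω)) _ _
  · ring

theorem smc_convergence
    {Ω E : Type*} [MeasurableSpace Ω] [MeasurableSpace E]
    (P : Measure Ω) [IsProbabilityMeasure P]
    (κ : ℝ) (hκ : 0 < κ)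
    (ℓ : ℕ → E → ℝ) (hℓmeas : ∀ n, Measurable (ℓ n))
    (hℓ : ∀ n u, κ ≤ ℓ n u ∧ ℓ n u ≤ 1 / κ)
    (K : ℕ → Kernel E E) (hK : ∀ n, IsMarkovKernel (K n))
    (ν : ℕ → Measure E) (hν0 : IsProbabilityMeasure (ν 0))
    (hνrec : ∀ n : ℕ, ν (n + 1) = PhiMap (ℓ n) (K (n + 1)) (ν n))
    (M : ℕ) (hM : 1 ≤ M)
    (νM : ℕ → Ω → Measure E)
    (hνM : ∀ n, IsRandomProbabilityMeasure (νM n))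
    (h0 : dRPM P (νM 0) (fun _ => ν 0) ≤ 1 / Real.sqrt M)
    (hstep : ∀ n : ℕ,
      dRPM P (νM (n + 1)) (fun ω => PhiMap (ℓ n) (K (n + 1)) (νM n ω)) ≤ 1 / Real.sqrt M) :
    ∀ n : ℕ,
      dRPM P (νM n) (fun _ => ν n) ≤
        ∑ j ∈ Finset.range (n + 1), (2 / κ ^ 2) ^ j * (1 / Real.sqrt M) := by
  have hprob : ∀ n, IsProbabilityMeasure (ν n) := by
    intro n
    induction n with
    | zero => exact hν0
    | succ n ih =>
      have := hK (n + 1)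
      rw [hνrec n]
      exact PhiMap_isProbabilityMeasure hκ (hℓmeas n) (hℓ n) (K (n + 1)) (ν n)
  have hs : 0 < 1 / Real.sqrt M := by
    have : (0 : ℝ) < M := by exact_mod_cast hM
    positivity
  intro n
  induction n with
  | zero => simpa using h0
  | succ n ih =>
    have := hK (n + 1)
    have := hprob n
    have hpos : 0 < ∑ j ∈ Finset.range (n + 1), (2 / κ ^ 2) ^ j * (1 / Real.sqrt M) :=
      Finset.sum_pos (fun j _ => by positivity) ⟨0, by simp⟩
    rw [hνrec n]
    refine (dRPM_PhiMap_le P hκ (hℓmeas n) (hℓ n) (K (n + 1)) (ν n) (hνM n) (hνM (n + 1))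
      hs hpos ih (hstep n)).trans_eq ?_
    rw [Finset.sum_range_succ' _ (n + 1), Finset.mul_sum, add_comm, pow_zero, one_mul]
    congr 1
    exact Finset.sum_congr rfl fun j _ => by ring
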